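/- arXiv:1011.4671 — 2 statements merged into one kernel-verified Lean document; each statement's English description precedes it below -/
import Mathlib

section
/- Let a_n = a_3(n,n,n) be the number of 3-dimensional rook walks from the origin to (n,n,n). Then for every n ≥ 0: 2(2+n)(3+n)²(53+35n)·a_{n+3} − (2+n)(43362 + 63493n + 30114n² + 4655n³)·a_{n+2} + (1+n)(54864 + 100586n + 59889n² + 11305n³)·a_{n+1} − 192n²(1+n)(88+35n)·a_n = 0. -/
/-- The set of `d`-dimensional rook walks from the origin to `v`: a walk is a
finite sequence of steps, each step adding a positive integer amount to
exactly one coordinate (a step is recorded as a pair of the chosen coordinate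
and the positive amount added). -/
def RookWalks (d : ℕ) (v : Fin d → ℕ) : Set (List (Fin d × ℕ)) :=
  {L | (∀ s ∈ L, 0 < s.2) ∧
       ∀ i : Fin d, (L.map (fun s => if s.1 = i then s.2 else 0)).sum = v i}

/-- The number of `d`-dimensional rook walks from the origin to `v`. -/
noncomputable def rookWalkCount (d : ℕ) (v : Fin d → ℕ) : ℕ :=
  (RookWalks d v).ncard

/-- Coefficients, as polynomials in `N` and `y`, of the powers of `x` in `rookCert N x y`. -/
def rookCertCoeff {R : Type*} [CommRing R] (N y : R) : Fin 4 → R :=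
  ![(-1272 - 1900 * N - 912 * N ^ 2 - 140 * N ^ 3)
      + (-8798 - 15668 * N - 9160 * N ^ 2 - 1750 * N ^ 3) * y ^ 2
      + (16112 + 31628 * N + 20008 * N ^ 2 + 4060 * N ^ 3) * y ^ 3
      + (-6996 * N - 7800 * N ^ 2 - 2100 * N ^ 3) * y ^ 4,
    (318 * N + 316 * N ^ 2 + 70 * N ^ 3)
      + (38592 + 57322 * N + 27642 * N ^ 2 + 4340 * N ^ 3) * y
      + (-20448 - 20265 * N - 3720 * N ^ 2 + 525 * N ^ 3) * y ^ 2
      + (-55470 - 111732 * N - 70974 * N ^ 2 - 14280 * N ^ 3) * y ^ 3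
      + (16654 * N + 17672 * N ^ 2 + 4690 * N ^ 3) * y ^ 4,
    (16854 + 24062 * N + 10978 * N ^ 2 + 1610 * N ^ 3)
      + (-102000 - 150538 * N - 72156 * N ^ 2 - 11270 * N ^ 3) * y
      + (74328 + 96230 * N + 37900 * N ^ 2 + 4550 * N ^ 3) * y ^ 2
      + (59856 + 118175 * N + 71788 * N ^ 2 + 13685 * N ^ 3) * y ^ 3
      + (3432 * N + 8754 * N ^ 2 + 2730 * N ^ 3) * y ^ 4,
    (-20988 - 30396 * N - 14100 * N ^ 2 - 2100 * N ^ 3)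
      + (64790 + 95260 * N + 45602 * N ^ 2 + 7140 * N ^ 3) * y
      + (-39116 - 49408 * N - 18440 * N ^ 2 - 2100 * N ^ 3) * y ^ 2
      + (-22440 - 37170 * N - 16830 * N ^ 2 - 2100 * N ^ 3) * y ^ 3
      + (-19008 * N - 26568 * N ^ 2 - 7560 * N ^ 3) * y ^ 4]

/-- The polynomial part of the telescoping certificate for the diagonal rook walk numbers. -/
def rookCert {R : Type*} [CommRing R] (N x y : R) : R :=
  rookCertCoeff N y 0 + rookCertCoeff N y 1 * x + rookCertCoeff N y 2 * x ^ 2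
    + rookCertCoeff N y 3 * x ^ 3

/-- The partial derivative of `rookCert N x y` with respect to `x`. -/
def rookCertDeriv {R : Type*} [CommRing R] (N x y : R) : R :=
  rookCertCoeff N y 1 + 2 * rookCertCoeff N y 2 * x + 3 * rookCertCoeff N y 3 * x ^ 2

/-- The creative telescoping identity, cleared of denominators: with `A` and `B` as below, the
generating functions of the recurrence add up to a sum of two logarithmic derivatives. -/
theorem rookCert_identity {R : Type*} [CommRing R] (N x y A B : R)
    (hA : A = 1 - 2 * x - 2 * y + 3 * x * y) (hB : B = 2 - 3 * x - 3 * y + 4 * x * y) :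
    2 * (2 + N) * (3 + N) ^ 2 * (53 + 35 * N) * B ^ 3
      - (2 + N) * (43362 + 63493 * N + 30114 * N ^ 2 + 4655 * N ^ 3) * (x * y) * A * B ^ 2
      + (1 + N) * (54864 + 100586 * N + 59889 * N ^ 2 + 11305 * N ^ 3) * (x * y) ^ 2 * A ^ 2 * B
      - 192 * N ^ 2 * (1 + N) * (88 + 35 * N) * (x * y) ^ 3 * A ^ 3
    = (1 - x) * (N * x * (4 * y - 3) * A - (N + 3) * x * (3 * y - 2) * B) * rookCert N x y
        + (x * ((1 - x) * rookCertDeriv N x y - 3 * rookCert N x y)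
          - (N + 3) * (1 - x) * rookCert N x y) * A * B
      + ((1 - y) * (N * y * (4 * x - 3) * A - (N + 3) * y * (3 * x - 2) * B) * rookCert N y x
        + (y * ((1 - y) * rookCertDeriv N y x - 3 * rookCert N y x)
          - (N + 3) * (1 - y) * rookCert N y x) * A * B) := by
  subst hA hB
  simp only [rookCert, rookCertDeriv, rookCertCoeff, Matrix.cons_val]
  ring

theorem cons_mem_rookWalks {d : ℕ} {v : Fin d → ℕ} {s : Fin d × ℕ} {L : List (Fin d × ℕ)} :
    s :: L ∈ RookWalks d v ↔ (0 < s.2 ∧ ∀ t ∈ L, 0 < t.2) ∧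
      ∀ j, (if s.1 = j then s.2 else 0) +
        (L.map (fun t => if t.1 = j then t.2 else 0)).sum = v j := by
  simp only [RookWalks, Set.mem_ofPred_eq, List.forall_mem_cons, List.map_cons, List.sum_cons]

theorem rookWalks_finite (d : ℕ) (v : Fin d → ℕ) : (RookWalks d v).Finite := by
  induction hN : ∑ i, v i using Nat.strong_induction_on generalizing v with
  | _ N ih =>
    subst hN
    refine ((Set.finite_singleton []).union (Set.finite_iUnion fun i : Fin d =>
      (Set.finite_Icc 1 (v i)).biUnion (t := fun k => List.cons (i, k) ''
        RookWalks d (Function.update v i (v i - k)))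
      fun k hk => Set.Finite.image _ ?_)).subset ?_
    · refine ih _ (Finset.sum_lt_sum (fun j _ => ?_) ⟨i, Finset.mem_univ i, ?_⟩) _ rfl
      · by_cases h : j = i
        · subst h
          simp
        · simp [h]
      · have := hk.1
        have := hk.2
        simp
        omega
    · rintro (_ | ⟨⟨i, k⟩, L⟩) hL
      · simp
      · obtain ⟨⟨hk, hL⟩, hsum⟩ := cons_mem_rookWalks.1 hL
        have hi := hsum i
        simp only [if_true] at hi hk
        have hk' : 1 ≤ k ∧ k ≤ v i := ⟨hk, by omega⟩
        refine Or.inr (Set.mem_iUnion.2 ⟨i, Set.mem_biUnion hk' ⟨L, ?_, rfl⟩⟩)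
        refine ⟨hL, fun j => ?_⟩
        have hj := hsum j
        by_cases h : i = j
        · subst h
          simp only [Function.update_self]
          omega
        · simp only [h, if_false, zero_add] at hj
          rw [Function.update_of_ne (Ne.symm h), hj]

/-- The rook walks to `v` whose first step is in direction `i`. -/
def RookWalksFrom (d : ℕ) (v : Fin d → ℕ) (i : Fin d) : Set (List (Fin d × ℕ)) :=
  {L ∈ RookWalks d v | L.head?.map Prod.fst = some i}

theorem rookWalksFrom_eq_empty {d : ℕ} {v : Fin d → ℕ} {i : Fin d} (h : v i = 0) :
    RookWalksFrom d v i = ∅ := by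
  refine Set.eq_empty_of_forall_notMem ?_
  rintro (_ | ⟨⟨j, k⟩, L⟩) ⟨hL, hi⟩
  · simp at hi
  · obtain rfl : j = i := by simpa using hi
    obtain ⟨⟨hk, -⟩, hsum⟩ := cons_mem_rookWalks.1 hL
    have := hsum j
    simp only [if_true] at this hk
    omega

/-- A walk is empty or has a first step, in some direction. -/
theorem rookWalkCount_eq_sum (d : ℕ) (v : Fin d → ℕ) :
    rookWalkCount d v = (if v = 0 then 1 else 0) + ∑ i, (RookWalksFrom d v i).ncard := by
  classical
  have hfin := rookWalks_finite d v
  have hcard := Finset.card_eq_sum_card_fiberwise (s := hfin.toFinset) (t := Finset.univ)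
    (f := fun L => L.head?.map Prod.fst) (fun _ _ => Finset.mem_coe.2 (Finset.mem_univ _))
  rw [Fintype.sum_option] at hcard
  rw [rookWalkCount, Set.ncard_eq_toFinset_card _ hfin, hcard]
  congr 1
  · split_ifs with hv
    · rw [Finset.card_eq_one]
      refine ⟨[], Finset.ext fun L => ?_⟩
      cases L <;> simp [RookWalks, hv]
    · rw [Finset.card_eq_zero]
      refine Finset.eq_empty_of_forall_notMem fun L hL => hv ?_
      cases L with
      | nil =>
        simp only [RookWalks, Finset.mem_filter, Set.Finite.mem_toFinset, Set.mem_ofPred_eq] at hL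
        funext j
        simpa using (hL.1.2 j).symm
      | cons s L => simp at hL
  · refine Finset.sum_congr rfl fun i _ => ?_
    rw [← Set.ncard_coe_finset]
    congr 1
    ext L
    simp [RookWalksFrom]

/-- A walk to `v + eᵢ` whose first step is in direction `i` either starts with a unit step, or its
first step can be shortened by one. -/
theorem ncard_rookWalksFrom_add_single {d : ℕ} (v : Fin d → ℕ) (i : Fin d) :
    (RookWalksFrom d (v + Pi.single i 1) i).ncard
      = rookWalkCount d v + (RookWalksFrom d v i).ncard := by
  have hset : RookWalksFrom d (v + Pi.single i 1) i = List.cons (i, 1) '' RookWalks d v ∪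
      List.modifyHead (fun s => (s.1, s.2 + 1)) '' RookWalksFrom d v i := by
    ext L
    constructor
    · rcases L with _ | ⟨⟨j, k⟩, L⟩
      · rintro ⟨-, hi⟩
        simp at hi
      · rintro ⟨hL, hi⟩
        obtain rfl : j = i := by simpa using hi
        obtain ⟨⟨hk, hpos⟩, hsum⟩ := cons_mem_rookWalks.1 hL
        obtain ⟨k, rfl⟩ : ∃ m, k = m + 1 := ⟨k - 1, by simp only at hk; omega⟩
        have hsum' : ∀ l, (if j = l then k else 0) +
            (L.map (fun t => if t.1 = l then t.2 else 0)).sum = v l := fun l => by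
          have := hsum l
          by_cases h : j = l
          · subst h
            simp only [if_true, Pi.add_apply, Pi.single_eq_same] at this ⊢
            omega
          · simpa [h, Pi.single_eq_of_ne (Ne.symm h)] using this
        rcases Nat.eq_zero_or_pos k with rfl | hk
        · exact Or.inl ⟨L, ⟨hpos, fun l => by simpa using hsum' l⟩, rfl⟩
        · exact Or.inr ⟨(j, k) :: L, ⟨cons_mem_rookWalks.2 ⟨⟨hk, hpos⟩, hsum'⟩, by simp⟩, rfl⟩
    · rintro (⟨L, hL, rfl⟩ | ⟨_ | ⟨⟨j, k⟩, L⟩, ⟨hL, hi⟩, rfl⟩)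
      · refine ⟨cons_mem_rookWalks.2 ⟨⟨Nat.one_pos, hL.1⟩, fun l => ?_⟩, by simp⟩
        rw [hL.2 l, Pi.add_apply, Pi.single_apply, add_comm]
        simp only [eq_comm]
      · simp at hi
      · obtain rfl : j = i := by simpa using hi
        obtain ⟨⟨hk, hpos⟩, hsum⟩ := cons_mem_rookWalks.1 hL
        refine ⟨cons_mem_rookWalks.2 ⟨⟨Nat.succ_pos k, hpos⟩, fun l => ?_⟩, by simp⟩
        rw [Pi.add_apply, ← hsum l, Pi.single_apply]
        by_cases h : j = l
        · subst h
          simp only [if_true]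
          omega
        · simp [h, Ne.symm h]
  have hfin := rookWalks_finite d v
  have hfin' : (RookWalksFrom d v i).Finite := hfin.subset (Set.sep_subset _ _)
  rw [hset, Set.ncard_union_eq _ (hfin.image _) (hfin'.image _),
    Set.ncard_image_of_injective _ List.cons_injective, Set.ncard_image_of_injective,
    rookWalkCount]
  · rintro (_ | ⟨⟨j, k⟩, L⟩) (_ | ⟨⟨j', k'⟩, L'⟩) h <;> simp_all
  · rw [Set.disjoint_left]
    rintro _ ⟨L, -, rfl⟩ ⟨_ | ⟨⟨j, k⟩, L'⟩, ⟨hL, -⟩, h⟩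
    · simp at h
    · have := (cons_mem_rookWalks.1 hL).1.1
      simp at h this
      omega

open MvPowerSeries in
theorem coeff_add_single_X_mul {σ R : Type*} [CommSemiring R] (i : σ) (m : σ →₀ ℕ)
    (f : MvPowerSeries σ R) : coeff (m + Finsupp.single i 1) (X i * f) = coeff m f := by
  rw [add_comm, X, coeff_add_monomial_mul, one_mul]

open MvPowerSeries in
theorem coeff_X_mul_of_apply_eq_zero {σ R : Type*} [CommSemiring R] {i : σ} {m : σ →₀ ℕ}
    (h : m i = 0) (f : MvPowerSeries σ R) : coeff m (X i * f) = 0 := by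
  classical
  rw [X, coeff_monomial_mul, if_neg]
  intro hle
  simpa [h] using hle i

open MvPowerSeries in
theorem coeff_X_mul_pderiv {σ R : Type*} [CommSemiring R] (i : σ) (m : σ →₀ ℕ)
    (f : MvPowerSeries σ R) : coeff m (X i * pderiv R i f) = m i * coeff m f := by
  by_cases h : m i = 0
  · rw [coeff_X_mul_of_apply_eq_zero h, h, Nat.cast_zero, zero_mul]
  · have hle : Finsupp.single i 1 ≤ m := Finsupp.single_le_iff.2 (Nat.one_le_iff_ne_zero.2 h)
    obtain ⟨k, rfl⟩ := exists_add_of_le hle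
    rw [add_comm, coeff_add_single_X_mul, coeff_pderiv, mul_comm]
    simp

/-- The generating function `∑ W (m₀, m₁, n) x ^ m₀ y ^ m₁` of an array `W`, for fixed `n`. -/
def sliceSeries (W : (Fin 3 → ℕ) → ℕ) (n : ℕ) : MvPowerSeries (Fin 2) ℤ :=
  fun m => W ![m 0, m 1, n]

theorem coeff_sliceSeries (W : (Fin 3 → ℕ) → ℕ) (n : ℕ) (m : Fin 2 →₀ ℕ) :
    MvPowerSeries.coeff m (sliceSeries W n) = W ![m 0, m 1, n] := rfl

/-- The slices of the trivariate generating function of rook walks. -/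
noncomputable def rookSeries (n : ℕ) : MvPowerSeries (Fin 2) ℤ :=
  sliceSeries (rookWalkCount 3) n

/-- The slices of the generating function of rook walks with first step in direction `i`. -/
noncomputable def rookSeriesFrom (i : Fin 3) (n : ℕ) : MvPowerSeries (Fin 2) ℤ :=
  sliceSeries (fun v => (RookWalksFrom 3 v i).ncard) n

theorem rookSeries_eq_sum (n : ℕ) :
    rookSeries n = (if n = 0 then 1 else 0) + ∑ i, rookSeriesFrom i n := by
  ext m
  have h : (![m 0, m 1, n] = 0) ↔ n = 0 ∧ m = 0 := by
    simp [funext_iff, Fin.forall_fin_succ, Finsupp.ext_iff]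
    tauto
  rw [rookSeries, coeff_sliceSeries, rookWalkCount_eq_sum]
  simp only [map_add, map_sum, rookSeriesFrom, coeff_sliceSeries, h]
  by_cases hn : n = 0 <;> by_cases hm : m = 0 <;>
    simp [hn, hm, MvPowerSeries.coeff_one]

theorem rookSeriesFrom_castSucc (i : Fin 2) (n : ℕ) :
    rookSeriesFrom i.castSucc n
      = MvPowerSeries.X i * (rookSeries n + rookSeriesFrom i.castSucc n) := by
  ext m
  by_cases h : m i = 0
  · rw [coeff_X_mul_of_apply_eq_zero h, rookSeriesFrom, coeff_sliceSeries,
      rookWalksFrom_eq_empty, Set.ncard_empty, Nat.cast_zero]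
    fin_cases i <;> exact h
  · have hle : Finsupp.single i 1 ≤ m := Finsupp.single_le_iff.2 (Nat.one_le_iff_ne_zero.2 h)
    obtain ⟨k, rfl⟩ := exists_add_of_le hle
    have hv : ![(Finsupp.single i 1 + k : Fin 2 →₀ ℕ) 0,
        (Finsupp.single i 1 + k : Fin 2 →₀ ℕ) 1, n] = ![k 0, k 1, n] + Pi.single i.castSucc 1 := by
      ext j
      fin_cases i <;> fin_cases j <;> simp [add_comm]
    rw [rookSeriesFrom, coeff_sliceSeries, hv, ncard_rookWalksFrom_add_single, add_comm _ k,
      coeff_add_single_X_mul, map_add, rookSeries, coeff_sliceSeries, coeff_sliceSeries,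
      Nat.cast_add]

theorem rookSeriesFrom_last_zero : rookSeriesFrom 2 0 = 0 := by
  ext m
  rw [rookSeriesFrom, coeff_sliceSeries, rookWalksFrom_eq_empty (by simp), Set.ncard_empty]
  simp

theorem rookSeriesFrom_last_succ (n : ℕ) :
    rookSeriesFrom 2 (n + 1) = rookSeries n + rookSeriesFrom 2 n := by
  ext m
  have hv : ![m 0, m 1, n + 1] = ![m 0, m 1, n] + Pi.single 2 1 := by
    ext j
    fin_cases j <;> simp
  rw [rookSeriesFrom, coeff_sliceSeries, hv, ncard_rookWalksFrom_add_single, map_add, rookSeries,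
    rookSeriesFrom, coeff_sliceSeries, coeff_sliceSeries, Nat.cast_add]

section Telescoping

open MvPowerSeries

local notation "x" => (X 0 : MvPowerSeries (Fin 2) ℤ)
local notation "y" => (X 1 : MvPowerSeries (Fin 2) ℤ)

/-- The denominator of the slices of the rook walk generating function. -/
noncomputable def rookDen : MvPowerSeries (Fin 2) ℤ := 1 - 2 * x - 2 * y + 3 * x * y

/-- The ratio of consecutive slices is `rookNum / rookDen`. -/
noncomputable def rookNum : MvPowerSeries (Fin 2) ℤ := 2 - 3 * x - 3 * y + 4 * x * y

theorem rookDen_mul_rookSeries (n : ℕ) :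
    rookDen * rookSeries n
      = (1 - x) * (1 - y) * ((if n = 0 then 1 else 0) + rookSeriesFrom 2 n) := by
  have h := rookSeries_eq_sum n
  have h0 := rookSeriesFrom_castSucc 0 n
  have h1 := rookSeriesFrom_castSucc 1 n
  rw [Fin.sum_univ_three] at h
  simp only [Fin.castSucc_zero, Fin.castSucc_one] at h0 h1
  rw [rookDen]
  linear_combination (1 - x) * (1 - y) * h + (1 - y) * h0 + (1 - x) * h1

theorem rookDen_sq_mul_rookSeries_one :
    rookDen ^ 2 * rookSeries 1 = ((1 - x) * (1 - y)) ^ 2 := by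
  have h0 := rookDen_mul_rookSeries 0
  have h1 := rookDen_mul_rookSeries 1
  rw [rookSeriesFrom_last_succ, rookSeriesFrom_last_zero] at h1
  rw [rookSeriesFrom_last_zero] at h0
  simp only [if_true, one_ne_zero, if_false] at h0 h1
  linear_combination rookDen * h1 + (1 - x) * (1 - y) * h0

theorem rookDen_mul_rookSeries_add_two (n : ℕ) :
    rookDen * rookSeries (n + 2) = rookNum * rookSeries (n + 1) := by
  have h1 := rookDen_mul_rookSeries (n + 1)
  have h2 := rookDen_mul_rookSeries (n + 2)
  rw [rookSeriesFrom_last_succ] at h2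
  simp only [Nat.add_eq_zero_iff, OfNat.ofNat_ne_zero, one_ne_zero, and_false, if_false] at h1 h2
  rw [rookDen] at *
  rw [rookNum]
  linear_combination h2 - h1

theorem rookDen_pow_mul_rookSeries_succ (n : ℕ) :
    rookDen ^ (n + 2) * rookSeries (n + 1) = ((1 - x) * (1 - y)) ^ 2 * rookNum ^ n := by
  induction n with
  | zero => simpa using rookDen_sq_mul_rookSeries_one
  | succ n ih =>
    linear_combination rookNum * ih + rookDen ^ (n + 2) * rookDen_mul_rookSeries_add_two n

/-- The inverse of `rookDen`. -/
noncomputable def rookDenInv : MvPowerSeries (Fin 2) ℤ := invOfUnit rookDen 1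

theorem rookDen_mul_rookDenInv : rookDen * rookDenInv = 1 :=
  mul_invOfUnit _ _ (by simp [rookDen])

theorem rookSeries_succ (n : ℕ) :
    rookSeries (n + 1) = ((1 - x) * (1 - y)) ^ 2 * rookNum ^ n * rookDenInv ^ (n + 2) := by
  rw [← rookDen_pow_mul_rookSeries_succ, mul_right_comm, ← mul_pow, rookDen_mul_rookDenInv,
    one_pow, one_mul]

theorem rookNum_ne_zero : rookNum ≠ 0 := by
  intro h
  have h2 : constantCoeff (2 : MvPowerSeries (Fin 2) ℤ) = 2 := map_ofNat _ 2
  simpa [rookNum, h2] using congrArg constantCoeff h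

theorem derivation_ofNat {K R : Type*} [CommRing K] [CommRing R] [Algebra K R]
    (D : Derivation K R R) (k : ℕ) [k.AtLeastTwo] : D (ofNat(k) : R) = 0 :=
  D.map_natCast k

theorem derivation_rookCert {K R : Type*} [CommRing K] [CommRing R] [Algebra K R]
    (D : Derivation K R R) (n : ℕ) {a b : R}
    (ha : D a = 1) (hb : D b = 0) : D (rookCert (n : R) a b) = rookCertDeriv (n : R) a b := by
  have hcoeff : ∀ k, D (rookCertCoeff (n : R) b k) = 0 := by
    intro k
    fin_cases k <;>
      simp [rookCertCoeff, Derivation.leibniz, Derivation.leibniz_pow, hb, derivation_ofNat]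
  simp only [rookCert, rookCertDeriv, map_add, Derivation.leibniz, Derivation.leibniz_pow, hcoeff,
    ha, smul_eq_mul, nsmul_eq_mul]
  push_cast
  ring

/-- The logarithmic derivative of the certificate, for a derivation `D` with `D a = 1` and
`D b = 0`. -/
theorem derivation_certificate {K R : Type*} [CommRing K] [CommRing R] [Algebra K R]
    (D : Derivation K R R) (n : ℕ)
    {a b A B I : R} (ha : D a = 1) (hb : D b = 0) (hA : A = 1 - 2 * a - 2 * b + 3 * a * b)
    (hB : B = 2 - 3 * a - 3 * b + 4 * a * b) (hI : A * I = 1) :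
    B * (a * D (((1 - a) * (1 - b)) ^ 2 * ((1 - a) * rookCert (n : R) a b) * B ^ n * I ^ (n + 3))
        - (n + 3) * (((1 - a) * (1 - b)) ^ 2 * ((1 - a) * rookCert (n : R) a b) * B ^ n
          * I ^ (n + 3)))
      = ((1 - a) * (1 - b)) ^ 2 * B ^ n * I ^ (n + 4) *
        ((1 - a) * (n * a * (4 * b - 3) * A - (n + 3) * a * (3 * b - 2) * B)
            * rookCert (n : R) a b
          + (a * ((1 - a) * rookCertDeriv (n : R) a b - 3 * rookCert (n : R) a b)
            - (n + 3) * (1 - a) * rookCert (n : R) a b) * A * B) := by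
  have hDA : D A = 3 * b - 2 := by
    simp [hA, Derivation.leibniz, ha, hb, derivation_ofNat]
    ring
  have hDB : D B = 4 * b - 3 := by
    simp [hB, Derivation.leibniz, ha, hb, derivation_ofNat]
    ring
  have hDI : D I = -I ^ 2 * (3 * b - 2) := by
    rw [D.leibniz_of_mul_eq_one (a := I) (b := A) (by rw [mul_comm, hI]), hDA, smul_eq_mul]
  have hDB' : B * D (B ^ n) = n * B ^ n * (4 * b - 3) := by
    rw [Derivation.leibniz_pow, hDB]
    cases n with
    | zero => simp
    | succ n =>
      simp only [nsmul_eq_mul, smul_eq_mul, Nat.add_sub_cancel]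
      ring
  have hDI' : D (I ^ (n + 3)) = -(n + 3) * I ^ (n + 4) * (3 * b - 2) := by
    rw [Derivation.leibniz_pow, hDI]
    simp only [nsmul_eq_mul, smul_eq_mul, show n + 3 - 1 = n + 2 from rfl]
    push_cast
    ring
  have hDc : D (((1 - a) * (1 - b)) ^ 2) = -2 * (1 - a) * (1 - b) ^ 2 := by
    simp [Derivation.leibniz, Derivation.leibniz_pow, ha, hb]
    ring
  have hDq : D ((1 - a) * rookCert (n : R) a b)
      = (1 - a) * rookCertDeriv (n : R) a b - rookCert (n : R) a b := by
    simp [Derivation.leibniz, ha, derivation_rookCert D n ha hb]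
    ring
  have hI' : I ^ (n + 3) = I ^ (n + 4) * A := by
    linear_combination (-I ^ (n + 3)) * hI
  rw [Derivation.leibniz _ _ (I ^ (n + 3)), Derivation.leibniz _ _ (B ^ n),
    Derivation.leibniz _ (((1 - a) * (1 - b)) ^ 2), hDI', hDc, hDq, hI']
  simp only [smul_eq_mul]
  linear_combination (a * I ^ (n + 4) * A * ((1 - a) * (1 - b)) ^ 2
    * ((1 - a) * rookCert (n : R) a b)) * hDB'

/-- The recurrence operator, applied to the slices of the generating function. -/
theorem rookSeries_telescoping (n : ℕ) : ∃ U V : MvPowerSeries (Fin 2) ℤ,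
    2 * (2 + (n : MvPowerSeries (Fin 2) ℤ)) * (3 + n) ^ 2 * (53 + 35 * n) * rookSeries (n + 3)
      - (2 + n) * (43362 + 63493 * n + 30114 * n ^ 2 + 4655 * n ^ 3)
        * (x * y * rookSeries (n + 2))
      + (1 + n) * (54864 + 100586 * n + 59889 * n ^ 2 + 11305 * n ^ 3)
        * (x * y * (x * y * rookSeries (n + 1)))
      - 192 * n ^ 2 * (1 + n) * (88 + 35 * n) * (x * y * (x * y * (x * y * rookSeries n)))
    = (x * pderiv ℤ 0 U - (n + 3) * U) + (y * pderiv ℤ 1 V - (n + 3) * V) := by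
  have hU := derivation_certificate (pderiv ℤ (0 : Fin 2)) n (a := x) (b := y) pderiv_X_self
    (pderiv_X_of_ne one_ne_zero) (A := rookDen) (B := rookNum) rfl rfl rookDen_mul_rookDenInv
  have hV := derivation_certificate (pderiv ℤ (1 : Fin 2)) n (a := y) (b := x) pderiv_X_self
    (pderiv_X_of_ne zero_ne_one) (A := rookDen) (B := rookNum) (by rw [rookDen]; ring)
    (by rw [rookNum]; ring) rookDen_mul_rookDenInv
  have hid := rookCert_identity (n : MvPowerSeries (Fin 2) ℤ) x y rookDen rookNum rfl rfl
  refine ⟨_, _, mul_left_cancel₀ rookNum_ne_zero (((?_ : _ = _).trans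
    (congrArg₂ (· + ·) hU hV).symm).trans (mul_add _ _ _).symm)⟩
  have hn : (n : MvPowerSeries (Fin 2) ℤ) * (rookNum * rookSeries n)
      = n * (((1 - x) * (1 - y)) ^ 2 * rookNum ^ n * rookDenInv ^ (n + 1)) := by
    cases n with
    | zero => simp
    | succ n =>
      rw [rookSeries_succ]
      ring
  have hI (k : ℕ) : rookDenInv ^ k = rookDenInv ^ (k + 1) * rookDen := by
    linear_combination (-rookDenInv ^ k) * rookDen_mul_rookDenInv
  rw [hI (n + 1), hI (n + 2), hI (n + 3)] at hn
  rw [rookSeries_succ (n + 2), rookSeries_succ (n + 1), rookSeries_succ n, hI (n + 2), hI (n + 3)]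
  linear_combination ((1 - x) * (1 - y)) ^ 2 * rookNum ^ n * rookDenInv ^ (n + 4) * hid
    - 192 * n * (1 + n) * (88 + 35 * n) * (x * y) ^ 3 * hn

/-- The exponent of `(x * y) ^ n`. -/
noncomputable def diagExponent (n : ℕ) : Fin 2 →₀ ℕ := Finsupp.equivFunOnFinite.symm fun _ => n

theorem coeff_diagExponent_succ (n : ℕ) (f : MvPowerSeries (Fin 2) ℤ) :
    coeff (diagExponent (n + 1)) (x * y * f) = coeff (diagExponent n) f := by
  have h : diagExponent (n + 1) = diagExponent n + Finsupp.single 1 1 + Finsupp.single 0 1 := by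
    ext i
    fin_cases i <;> simp [diagExponent]
  rw [h, mul_assoc, coeff_add_single_X_mul, coeff_add_single_X_mul]

theorem coeff_diagExponent_rookSeries (n : ℕ) :
    coeff (diagExponent n) (rookSeries n) = rookWalkCount 3 (fun _ => n) := by
  rw [rookSeries, coeff_sliceSeries]
  congr 2
  ext i
  fin_cases i <;> rfl

theorem coeff_intCast_mul (m : Fin 2 →₀ ℕ) (k : ℤ) (f : MvPowerSeries (Fin 2) ℤ) :
    coeff m ((k : MvPowerSeries (Fin 2) ℤ) * f) = k * coeff m f := by
  rw [← zsmul_eq_mul, map_zsmul, smul_eq_mul]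

theorem coeff_diagExponent_derivation (i : Fin 2) (n : ℕ) (U : MvPowerSeries (Fin 2) ℤ) :
    coeff (diagExponent (n + 3))
      (X i * pderiv ℤ i U - ((n : MvPowerSeries (Fin 2) ℤ) + 3) * U) = 0 := by
  have h := coeff_intCast_mul (diagExponent (n + 3)) (n + 3) U
  push_cast at h
  rw [map_sub, coeff_X_mul_pderiv, h]
  simp [diagExponent]

end Telescoping

/-- Chyzak et al.'s recurrence for the diagonal 3-dimensional rook walk numbers
`aₙ = a₃(n,n,n)`:
`2(2+n)(3+n)²(53+35n)·a_{n+3} − (2+n)(43362+63493n+30114n²+4655n³)·a_{n+2}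
 + (1+n)(54864+100586n+59889n²+11305n³)·a_{n+1} − 192n²(1+n)(88+35n)·aₙ = 0`. -/
theorem rook_diag_recurrence_three_dim (n : ℕ) :
    2 * (2 + (n : ℤ)) * (3 + (n : ℤ)) ^ 2 * (53 + 35 * (n : ℤ))
        * (rookWalkCount 3 (fun _ => n + 3) : ℤ)
      - (2 + (n : ℤ)) * (43362 + 63493 * (n : ℤ) + 30114 * (n : ℤ) ^ 2
            + 4655 * (n : ℤ) ^ 3)
        * (rookWalkCount 3 (fun _ => n + 2) : ℤ)
      + (1 + (n : ℤ)) * (54864 + 100586 * (n : ℤ) + 59889 * (n : ℤ) ^ 2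
            + 11305 * (n : ℤ) ^ 3)
        * (rookWalkCount 3 (fun _ => n + 1) : ℤ)
      - 192 * (n : ℤ) ^ 2 * (1 + (n : ℤ)) * (88 + 35 * (n : ℤ))
        * (rookWalkCount 3 (fun _ => n) : ℤ) = 0 := by
  obtain ⟨U, V, h⟩ := rookSeries_telescoping n
  have hc := congrArg (MvPowerSeries.coeff (diagExponent (n + 3))) h
  have hcast := coeff_intCast_mul (diagExponent (n + 3))
  have h3 := hcast (2 * (2 + n) * (3 + n) ^ 2 * (53 + 35 * n)) (rookSeries (n + 3))
  have h2 := hcast ((2 + n) * (43362 + 63493 * n + 30114 * n ^ 2 + 4655 * n ^ 3))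
    (MvPowerSeries.X 0 * MvPowerSeries.X 1 * rookSeries (n + 2))
  have h1 := hcast ((1 + n) * (54864 + 100586 * n + 59889 * n ^ 2 + 11305 * n ^ 3))
    (MvPowerSeries.X 0 * MvPowerSeries.X 1 *
      (MvPowerSeries.X 0 * MvPowerSeries.X 1 * rookSeries (n + 1)))
  have h0 := hcast (192 * n ^ 2 * (1 + n) * (88 + 35 * n))
    (MvPowerSeries.X 0 * MvPowerSeries.X 1 * (MvPowerSeries.X 0 * MvPowerSeries.X 1 *
      (MvPowerSeries.X 0 * MvPowerSeries.X 1 * rookSeries n)))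
  simp only [coeff_diagExponent_succ, coeff_diagExponent_rookSeries] at h0 h1 h2 h3
  push_cast at h0 h1 h2 h3
  rw [map_add, coeff_diagExponent_derivation, coeff_diagExponent_derivation, map_sub, map_add,
    map_sub, h0, h1, h2, h3, add_zero] at hc
  exact hc
end

section
/- Fix d ≥ 2 and let α_d = d^{d+2} / ((d+2)^{d−1} (d+1)² 2^{d−1}). Then the diagonal d-dimensional rook walk numbers satisfy a_d(n,…,n) ~ √(α_d) · (nπ)^{(1−d)/2} · ((d+1)^d)^n as n → ∞; that is, the quotient a_d(n,…,n) / (√(α_d) · (nπ)^{(1−d)/2} · (d+1)^{dn}) tends to 1 as n → ∞. -/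
open Filter Real

theorem nil_mem_rookWalks_iff {d : ℕ} {v : Fin d → ℕ} : [] ∈ RookWalks d v ↔ v = 0 := by
  simp [RookWalks, funext_iff, eq_comm]

theorem cons_mem_rookWalks_iff {d : ℕ} {v : Fin d → ℕ} {s : Fin d × ℕ} {L : List (Fin d × ℕ)} :
    s :: L ∈ RookWalks d v ↔
      0 < s.2 ∧ s.2 ≤ v s.1 ∧ L ∈ RookWalks d (Function.update v s.1 (v s.1 - s.2)) := by
  simp only [RookWalks, Set.mem_ofPred_eq, List.forall_mem_cons, List.map_cons, List.sum_cons]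
  constructor
  · rintro ⟨⟨h0, h1⟩, h2⟩
    have h3 := h2 s.1
    simp only [if_true] at h3
    refine ⟨h0, by omega, h1, fun i => ?_⟩
    by_cases hi : i = s.1
    · subst hi
      simp only [Function.update_self]
      omega
    · have := h2 i
      rw [if_neg (Ne.symm hi)] at this
      rw [Function.update_of_ne hi]
      omega
  · rintro ⟨h0, hle, h1, h2⟩
    refine ⟨⟨h0, h1⟩, fun i => ?_⟩
    have := h2 i
    by_cases hi : i = s.1
    · subst hi
      simp only [Function.update_self] at this
      simp only [if_true]
      omega
    · rw [Function.update_of_ne hi] at this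
      rw [if_neg (Ne.symm hi)]
      omega

theorem exists_finset_rookWalks {d : ℕ} (A : (Fin d → ℕ) → ℝ)
    (hA : ∀ v, A v = (if v = 0 then 1 else 0) +
      ∑ i, ∑ c ∈ Finset.range (v i), A (Function.update v i c)) (v : Fin d → ℕ) :
    ∃ S : Finset (List (Fin d × ℕ)), (S : Set (List (Fin d × ℕ))) = RookWalks d v ∧
      (S.card : ℝ) = A v := by
  induction hm : ∑ i, v i using Nat.strong_induction_on generalizing v with
  | _ m ih =>
  have hlt : ∀ i, ∀ c < v i, ∑ j, Function.update v i c j < m := by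
    intro i c hc
    rw [← hm]
    refine Finset.sum_lt_sum (fun j _ => ?_) ⟨i, Finset.mem_univ _, by simpa using hc⟩
    by_cases hj : j = i
    · subst hj; simpa using hc.le
    · simp [hj]
  have hex : ∀ i c, ∃ S : Finset (List (Fin d × ℕ)), c < v i →
      (S : Set (List (Fin d × ℕ))) = RookWalks d (Function.update v i c) ∧
      (S.card : ℝ) = A (Function.update v i c) := by
    intro i c
    by_cases hc : c < v i
    · obtain ⟨S, hS⟩ := ih _ (hlt i c hc) _ rfl
      exact ⟨S, fun _ => hS⟩
    · exact ⟨∅, fun h => absurd h hc⟩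
  choose S hS using hex
  let T : Finset (Σ _ : Fin d, Σ _ : ℕ, List (Fin d × ℕ)) :=
    Finset.univ.sigma fun i => (Finset.range (v i)).sigma fun c => S i c
  let f : (Σ _ : Fin d, Σ _ : ℕ, List (Fin d × ℕ)) → List (Fin d × ℕ) :=
    fun x => (x.1, v x.1 - x.2.1) :: x.2.2
  have hf : Set.InjOn f T := by
    rintro ⟨i, c, L⟩ h ⟨i', c', L'⟩ h' heq
    simp only [T, Finset.coe_sigma, Set.mem_sigma_iff, Finset.mem_coe,
      Finset.mem_range] at h h'
    simp only [f, List.cons.injEq, Prod.mk.injEq] at heq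
    obtain ⟨⟨rfl, h1⟩, rfl⟩ := heq
    have : c = c' := by omega
    subst this
    rfl
  have hdisj : Disjoint (if v = 0 then {[]} else ∅ : Finset (List (Fin d × ℕ))) (T.image f) := by
    rw [Finset.disjoint_left]
    intro L hL hL'
    obtain ⟨x, -, rfl⟩ := Finset.mem_image.1 hL'
    split_ifs at hL <;> simp [f] at hL
  refine ⟨(if v = 0 then {[]} else ∅) ∪ T.image f, ?_, ?_⟩
  · ext L
    rw [Finset.mem_coe, Finset.mem_union]
    cases L with
    | nil =>
      rw [nil_mem_rookWalks_iff]
      by_cases hv : v = 0 <;> simp [hv, f]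
    | cons s L =>
      have h0 : s :: L ∉ (if v = 0 then {[]} else ∅ : Finset (List (Fin d × ℕ))) := by
        split_ifs <;> simp
      rw [cons_mem_rookWalks_iff, or_iff_right h0, Finset.mem_image]
      constructor
      · rintro ⟨⟨i, c, L'⟩, hx, heq⟩
        simp only [T, Finset.mem_sigma, Finset.mem_univ, true_and, Finset.mem_range] at hx
        simp only [f, List.cons.injEq] at heq
        obtain ⟨rfl, rfl⟩ := heq
        have hc := hx.1
        have := hx.2
        rw [← Finset.mem_coe, (hS i c hc).1] at this
        refine ⟨by simpa using hc, by simp, ?_⟩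
        have e : v i - (v i - c) = c := by omega
        simpa only [e] using this
      · rintro ⟨hpos, hle, hL⟩
        refine ⟨⟨s.1, v s.1 - s.2, L⟩, ?_, ?_⟩
        · have hc : v s.1 - s.2 < v s.1 := by omega
          simp only [T, Finset.mem_sigma, Finset.mem_univ, true_and, Finset.mem_range]
          refine ⟨hc, ?_⟩
          rw [← Finset.mem_coe, (hS _ _ hc).1]
          exact hL
        · have e : v s.1 - (v s.1 - s.2) = s.2 := by omega
          simp only [f, e]
  · rw [Finset.card_union_of_disjoint hdisj, Finset.card_image_of_injOn hf, hA v,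
      Finset.card_sigma]
    push_cast
    congr 1
    · split_ifs <;> simp
    · refine Finset.sum_congr rfl fun i _ => ?_
      rw [Finset.card_sigma]
      push_cast
      exact Finset.sum_congr rfl fun c hc => (hS i c (Finset.mem_range.1 hc)).2

/-- Rook walk numbers are determined by the recursion on the first step of a walk. -/
theorem rookWalkCount_eq_of_recursion {d : ℕ} (A : (Fin d → ℕ) → ℝ)
    (hA : ∀ v, A v = (if v = 0 then 1 else 0) +
      ∑ i, ∑ c ∈ Finset.range (v i), A (Function.update v i c)) (v : Fin d → ℕ) :
    (rookWalkCount d v : ℝ) = A v := by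
  obtain ⟨S, hS, hcard⟩ := exists_finset_rookWalks A hA v
  rw [rookWalkCount, ← hS, Set.ncard_coe_finset, hcard]

open Polynomial MeasureTheory in
theorem integrableOn_exp_neg_mul_eval (P : ℝ[X]) :
    IntegrableOn (fun t => exp (-t) * P.eval t) (Set.Ioi 0) := by
  induction P using Polynomial.induction_on' with
  | add p q hp hq =>
    simp only [eval_add, mul_add]
    exact hp.add hq
  | monomial n a =>
    have : IntegrableOn (fun t : ℝ => a * (exp (-t) * t ^ ((n : ℝ) + 1 - 1))) (Set.Ioi 0) :=
      (Real.GammaIntegral_convergent (s := n + 1) (by positivity)).const_mul a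
    refine this.congr_fun (fun t ht => ?_) measurableSet_Ioi
    simp only [eval_monomial, add_sub_cancel_right, rpow_natCast]
    ring

open Polynomial MeasureTheory in
theorem integral_exp_neg_mul_eval (P : ℝ[X]) :
    ∫ t in Set.Ioi (0 : ℝ), exp (-t) * P.eval t =
      P.eval 0 + ∫ t in Set.Ioi (0 : ℝ), exp (-t) * (derivative P).eval t := by
  have hderiv : ∀ t : ℝ, HasDerivAt (fun t => exp (-t) * P.eval t)
      (exp (-t) * (derivative P).eval t - exp (-t) * P.eval t) t := by
    intro t
    have := ((hasDerivAt_neg t).exp).mul (P.hasDerivAt t)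
    refine this.congr_deriv ?_
    ring
  have hinteg := (integrableOn_exp_neg_mul_eval (derivative P)).sub (integrableOn_exp_neg_mul_eval P)
  have hlim : Tendsto (fun t => exp (-t) * P.eval t) atTop (nhds 0) := by
    refine P.tendsto_div_exp_atTop.congr fun t => ?_
    rw [exp_neg, div_eq_inv_mul]
  have := integral_Ioi_of_hasDerivAt_of_tendsto (a := 0) (hderiv 0).continuousAt.continuousWithinAt
    (fun t _ => hderiv t) hinteg hlim
  rw [integral_sub (integrableOn_exp_neg_mul_eval _) (integrableOn_exp_neg_mul_eval _)] at this
  simp only [neg_zero, exp_zero, one_mul, zero_sub] at this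
  linarith

open Polynomial in
/-- The coefficient of `x ^ n` in `exp (X * x / (1 - x))`. -/
noncomputable def rookPoly : ℕ → ℝ[X]
  | 0 => 1
  | N + 1 => ∑ j ∈ Finset.range (N + 1),
      Polynomial.C ((N.choose j : ℝ) / (j + 1).factorial) * X ^ (j + 1)

open Polynomial in
theorem derivative_rookPoly_succ (N : ℕ) :
    derivative (rookPoly (N + 1)) = ∑ j ∈ Finset.range (N + 1),
      Polynomial.C ((N.choose j : ℝ) / j.factorial) * X ^ j := by
  simp only [rookPoly, derivative_sum]
  refine Finset.sum_congr rfl fun j _ => ?_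
  rw [derivative_C_mul_X_pow, Nat.add_sub_cancel, Nat.factorial_succ]
  congr 2
  have : (j.factorial : ℝ) ≠ 0 := by positivity
  push_cast
  field_simp

open Polynomial in
theorem derivative_rookPoly (n : ℕ) :
    derivative (rookPoly n) = ∑ c ∈ Finset.range n, rookPoly c := by
  induction n with
  | zero => simp [rookPoly]
  | succ n ih =>
    rw [Finset.sum_range_succ, ← ih]
    cases n with
    | zero => simp [rookPoly]
    | succ N =>
      rw [derivative_rookPoly_succ (N + 1), derivative_rookPoly_succ N, Finset.sum_range_succ',
        Finset.sum_range_succ' (fun j => Polynomial.C ((N.choose j : ℝ) / j.factorial) * X ^ j),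
        rookPoly]
      have h : ∑ j ∈ Finset.range (N + 1),
            Polynomial.C (((N + 1).choose (j + 1) : ℝ) / (j + 1).factorial) * X ^ (j + 1) =
          ∑ j ∈ Finset.range N,
            Polynomial.C ((N.choose (j + 1) : ℝ) / (j + 1).factorial) * X ^ (j + 1) +
          ∑ j ∈ Finset.range (N + 1),
            Polynomial.C ((N.choose j : ℝ) / (j + 1).factorial) * X ^ (j + 1) := by
        have h' : ∑ j ∈ Finset.range N,
            Polynomial.C ((N.choose (j + 1) : ℝ) / (j + 1).factorial) * X ^ (j + 1) =
            ∑ j ∈ Finset.range (N + 1),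
            Polynomial.C ((N.choose (j + 1) : ℝ) / (j + 1).factorial) * X ^ (j + 1) := by
          rw [Finset.sum_range_succ]; simp
        rw [h', ← Finset.sum_add_distrib]
        refine Finset.sum_congr rfl fun j _ => ?_
        rw [← add_mul, ← map_add, ← add_div, Nat.choose_succ_succ]
        push_cast
        rw [add_comm]
      rw [h]
      simp only [Nat.choose_zero_right]
      abel

theorem eval_zero_rookPoly (n : ℕ) : (rookPoly n).eval 0 = if n = 0 then 1 else 0 := by
  cases n with
  | zero => simp [rookPoly]
  | succ N => simp [rookPoly, Polynomial.eval_finsetSum]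

open MeasureTheory in
theorem rookWalkCount_eq_integral (d : ℕ) (v : Fin d → ℕ) :
    (rookWalkCount d v : ℝ) =
      ∫ t in Set.Ioi (0 : ℝ), exp (-t) * ∏ i, (rookPoly (v i)).eval t := by
  refine rookWalkCount_eq_of_recursion
    (fun v => ∫ t in Set.Ioi (0 : ℝ), exp (-t) * ∏ i, (rookPoly (v i)).eval t) (fun v => ?_) v
  simp only [← Polynomial.eval_prod]
  rw [integral_exp_neg_mul_eval]
  congr 1
  · rw [Polynomial.eval_prod]
    simp only [eval_zero_rookPoly, Finset.prod_ite_zero, funext_iff]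
    simp
  · have h : ∀ t, exp (-t) * (Polynomial.derivative (∏ i, rookPoly (v i))).eval t =
        ∑ i, ∑ c ∈ Finset.range (v i),
          exp (-t) * (∏ j, rookPoly (Function.update v i c j)).eval t := by
      intro t
      rw [Polynomial.derivative_prod_finset]
      simp only [Polynomial.eval_finsetSum, derivative_rookPoly, Finset.mul_sum]
      refine Finset.sum_congr rfl fun i _ => Finset.sum_congr rfl fun c _ => ?_
      have : (fun j => rookPoly (Function.update v i c j)) =
          Function.update (fun j => rookPoly (v j)) i (rookPoly c) := by
        ext1 j
        by_cases hj : j = i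
        · subst hj; simp
        · simp [hj]
      rw [this, Finset.prod_update_of_mem (Finset.mem_univ i), Finset.sdiff_singleton_eq_erase,
        mul_comm (rookPoly c)]
    simp only [h]
    rw [integral_finsetSum _ fun i _ => integrable_finsetSum _ fun c _ =>
      integrableOn_exp_neg_mul_eval _]
    exact Finset.sum_congr rfl fun i _ => integral_finsetSum _ fun c _ =>
      integrableOn_exp_neg_mul_eval _

section GammaDensity

open MeasureTheory Set FourierTransform

/-- The density of the sum of `k + 1` independent standard exponential variables. -/
noncomputable def erlangDensity (k : ℕ) : ℝ → ℝ :=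
  (Ioi 0).indicator fun u => exp (-u) * u ^ k / k.factorial

theorem erlangDensity_nonneg (k : ℕ) (u : ℝ) : 0 ≤ erlangDensity k u :=
  indicator_nonneg (fun u (hu : 0 < u) => by positivity) u

theorem integrableOn_exp_neg_mul_pow (k : ℕ) :
    IntegrableOn (fun u => exp (-u) * u ^ k) (Ioi 0) := by
  simpa using integrableOn_exp_neg_mul_eval (Polynomial.X ^ k)

theorem integrable_erlangDensity (k : ℕ) : Integrable (erlangDensity k) :=
  IntegrableOn.integrable_indicator ((integrableOn_exp_neg_mul_pow k).div_const _) measurableSet_Ioi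

theorem integral_erlangDensity (k : ℕ) : ∫ u, erlangDensity k u = 1 := by
  rw [erlangDensity, integral_indicator measurableSet_Ioi, integral_div,
    ← Real.Gamma_nat_eq_factorial, Real.Gamma_eq_integral (by positivity)]
  simp only [add_sub_cancel_right, rpow_natCast]
  refine div_self ?_
  have := Real.Gamma_eq_integral (s := k + 1) (by positivity)
  simp only [add_sub_cancel_right, rpow_natCast] at this
  rw [← this]
  exact (Real.Gamma_pos_of_pos (by positivity)).ne'

theorem continuous_erlangDensity_succ (k : ℕ) : Continuous (erlangDensity (k + 1)) := by
  have h : erlangDensity (k + 1) =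
      fun u => exp (-u) * (max u 0) ^ (k + 1) / (k + 1).factorial := by
    ext u
    by_cases hu : 0 < u
    · rw [erlangDensity, indicator_of_mem (mem_Ioi.2 hu), max_eq_left hu.le]
    · rw [erlangDensity, indicator_of_notMem (by simpa using hu), max_eq_right (not_lt.1 hu)]
      simp
  rw [h]
  fun_prop

theorem integrableOn_pow_mul_cexp (z : ℂ) (hz : z.re = 1) (k : ℕ) :
    IntegrableOn (fun u : ℝ => (u : ℂ) ^ k * Complex.exp (-z * u)) (Ioi 0) := by
  refine (integrableOn_exp_neg_mul_pow k).mono'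
    (Continuous.aestronglyMeasurable (by fun_prop)) ?_
  refine (ae_restrict_iff' measurableSet_Ioi).2 (ae_of_all _ fun u (hu : 0 < u) => le_of_eq ?_)
  rw [norm_mul, norm_pow, Complex.norm_real, Complex.norm_exp, norm_of_nonneg hu.le]
  simp [hz, mul_comm]

theorem integral_pow_mul_cexp (z : ℂ) (hz : z.re = 1) (k : ℕ) :
    ∫ u in Ioi (0 : ℝ), (u : ℂ) ^ k * Complex.exp (-z * u) = k.factorial / z ^ (k + 1) := by
  have hz0 : z ≠ 0 := by rintro rfl; simp at hz
  induction k with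
  | zero =>
    have := integral_exp_mul_complex_Ioi (a := -z) (by simp [hz]) 0
    simpa [neg_div_neg_eq] using this
  | succ k ih =>
    have hderiv : ∀ u : ℝ, HasDerivAt (fun u : ℝ => (u : ℂ) ^ (k + 1) * Complex.exp (-z * u))
        ((k + 1) * ((u : ℂ) ^ k * Complex.exp (-z * u)) -
          z * ((u : ℂ) ^ (k + 1) * Complex.exp (-z * u))) u := by
      intro u
      have h1 : HasDerivAt (fun u : ℂ => u ^ (k + 1) * Complex.exp (-z * u))
          ((k + 1) * ((u : ℂ) ^ k * Complex.exp (-z * u)) -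
          z * ((u : ℂ) ^ (k + 1) * Complex.exp (-z * u))) (u : ℂ) := by
        have := (hasDerivAt_pow (k + 1) (u : ℂ)).mul
          ((hasDerivAt_id (u : ℂ)).const_mul (-z)).cexp
        refine this.congr_deriv ?_
        simp only [Nat.add_sub_cancel, Nat.cast_add, Nat.cast_one, id]
        ring
      exact h1.comp_ofReal
    have hlim : Tendsto (fun u : ℝ => (u : ℂ) ^ (k + 1) * Complex.exp (-z * u)) atTop
        (nhds 0) := by
      rw [tendsto_zero_iff_norm_tendsto_zero]
      refine (tendsto_pow_mul_exp_neg_atTop_nhds_zero (k + 1)).congr' ?_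
      filter_upwards [eventually_gt_atTop 0] with u hu
      rw [norm_mul, norm_pow, Complex.norm_real, Complex.norm_exp, norm_of_nonneg hu.le]
      simp [hz]
    have h1 := (integrableOn_pow_mul_cexp z hz k).const_mul ((k : ℂ) + 1)
    have h2 := (integrableOn_pow_mul_cexp z hz (k + 1)).const_mul z
    have := integral_Ioi_of_hasDerivAt_of_tendsto (a := 0)
      (hderiv 0).continuousAt.continuousWithinAt (fun t _ => hderiv t) (h1.sub h2) hlim
    rw [integral_sub h1 h2, integral_const_mul, integral_const_mul, ih] at this
    simp only [Complex.ofReal_zero, ne_eq, Nat.add_eq_zero_iff, one_ne_zero, and_false,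
      not_false_eq_true, zero_pow, zero_mul, sub_zero, sub_eq_zero] at this
    rw [← mul_right_injective₀ hz0 |>.eq_iff]
    rw [← this, Nat.factorial_succ]
    push_cast
    field_simp
    ring

theorem fourier_erlangDensity (k : ℕ) (ξ : ℝ) :
    𝓕 (fun u => (erlangDensity k u : ℂ)) ξ = 1 / (1 + (2 * π * ξ : ℝ) * Complex.I) ^ (k + 1) := by
  rw [Real.fourier_real_eq_integral_exp_smul]
  have h : ∀ u : ℝ, Complex.exp ((-2 * π * u * ξ : ℝ) * Complex.I) • (erlangDensity k u : ℂ) =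
      (Ioi (0 : ℝ)).indicator (fun u : ℝ => ((u : ℂ) ^ k *
        Complex.exp (-(1 + (2 * π * ξ : ℝ) * Complex.I) * u)) / k.factorial) u := by
    intro u
    by_cases hu : 0 < u
    · rw [erlangDensity, indicator_of_mem (mem_Ioi.2 hu), indicator_of_mem (mem_Ioi.2 hu)]
      have : -(1 + (2 * π * ξ : ℝ) * Complex.I) * (u : ℂ) =
          (-2 * π * u * ξ : ℝ) * Complex.I + (-u : ℝ) := by push_cast; ring
      rw [this, Complex.exp_add, smul_eq_mul]
      push_cast
      ring
    · rw [erlangDensity, indicator_of_notMem (by simpa using hu),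
        indicator_of_notMem (by simpa using hu)]
      simp
  simp only [h]
  rw [integral_indicator measurableSet_Ioi, integral_div, integral_pow_mul_cexp _ (by simp)]
  have : (k.factorial : ℂ) ≠ 0 := by exact_mod_cast k.factorial_ne_zero
  field_simp

theorem one_add_mul_I_ne_zero (x : ℝ) : 1 + (x : ℂ) * Complex.I ≠ 0 := fun h => by
  simpa using congrArg Complex.re h

theorem norm_one_add_mul_I_sq (x : ℝ) : ‖1 + (x : ℂ) * Complex.I‖ ^ 2 = 1 + x ^ 2 := by
  rw [← Complex.normSq_eq_norm_sq, Complex.normSq_apply]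
  simp
  ring

theorem one_le_norm_one_add_mul_I (x : ℝ) : 1 ≤ ‖1 + (x : ℂ) * Complex.I‖ := by
  have := norm_one_add_mul_I_sq x
  nlinarith [norm_nonneg (1 + (x : ℂ) * Complex.I), sq_nonneg x]

theorem integrable_one_div_one_add_mul_I_pow (k : ℕ) :
    Integrable fun ξ : ℝ => 1 / (1 + (2 * π * ξ : ℝ) * Complex.I) ^ (k + 2) := by
  have h := integrable_inv_one_add_sq.comp_mul_left' (R := 2 * π) (by positivity)
  refine h.mono' (Continuous.aestronglyMeasurable ?_) (ae_of_all _ fun ξ => ?_)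
  · refine continuous_const.div (by fun_prop) fun ξ => pow_ne_zero _ (one_add_mul_I_ne_zero _)
  · rw [norm_div, norm_one, norm_pow, ← norm_one_add_mul_I_sq, ← one_div]
    have := one_le_norm_one_add_mul_I (2 * π * ξ)
    refine one_div_le_one_div_of_le (by positivity) (pow_le_pow_right₀ this (by omega))

theorem erlangDensity_succ_eq_integral (k : ℕ) (u : ℝ) :
    (erlangDensity (k + 1) u : ℂ) = ∫ ξ : ℝ, Complex.exp ((2 * π * ξ * u : ℝ) * Complex.I) *
      (1 / (1 + (2 * π * ξ : ℝ) * Complex.I) ^ (k + 2)) := by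
  have hF : 𝓕 (fun u => (erlangDensity (k + 1) u : ℂ)) =
      fun ξ : ℝ => 1 / (1 + (2 * π * ξ : ℝ) * Complex.I) ^ (k + 2) := by
    ext ξ
    exact fourier_erlangDensity (k + 1) ξ
  have h := Continuous.fourierInv_fourier_eq (f := fun u => (erlangDensity (k + 1) u : ℂ))
    (Complex.continuous_ofReal.comp (continuous_erlangDensity_succ k))
    (integrable_erlangDensity (k + 1)).ofReal
    (by rw [hF]; exact integrable_one_div_one_add_mul_I_pow k)
  rw [← congrFun h u, hF, Real.fourierInv_eq']
  refine integral_congr_ae (ae_of_all _ fun ξ => ?_)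
  simp only [smul_eq_mul, RCLike.inner_apply, conj_trivial]
  congr 4
  ring

end GammaDensity

section GammaMixture

open MeasureTheory Set

/-- The density of the sum of `K + 2` independent standard exponential variables, where `K` is
binomial with parameters `N` and `q`. -/
noncomputable def binomialErlangDensity (q : ℝ) (N : ℕ) (u : ℝ) : ℝ :=
  ∑ j ∈ Finset.range (N + 1), q ^ j * (1 - q) ^ (N - j) * N.choose j * erlangDensity (j + 1) u

theorem binomialErlangDensity_nonneg {q : ℝ} (hq0 : 0 ≤ q) (hq1 : q ≤ 1) (N : ℕ) (u : ℝ) :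
    0 ≤ binomialErlangDensity q N u := by
  refine Finset.sum_nonneg fun j _ => mul_nonneg ?_ (erlangDensity_nonneg _ _)
  have : 0 ≤ 1 - q := by linarith
  positivity

theorem integral_binomialErlangDensity (q : ℝ) (N : ℕ) :
    ∫ u, binomialErlangDensity q N u = 1 := by
  simp only [binomialErlangDensity]
  rw [integral_finsetSum _ fun j _ => (integrable_erlangDensity (j + 1)).const_mul _]
  simp only [integral_const_mul, integral_erlangDensity, mul_one]
  rw [← add_pow]
  simp

/-- The characteristic function of a variable equal to `0` with probability `1 - q` and standard
exponential with probability `q`. -/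
noncomputable def thinnedExpCharFun (q θ : ℝ) : ℂ :=
  (1 - q : ℝ) + q / (1 + θ * Complex.I)

theorem binomialErlangDensity_eq_integral (q : ℝ) (N : ℕ) (u : ℝ) :
    (binomialErlangDensity q N u : ℂ) = ∫ ξ : ℝ, Complex.exp ((2 * π * ξ * u : ℝ) * Complex.I) *
      (thinnedExpCharFun q (2 * π * ξ) ^ N / (1 + (2 * π * ξ : ℝ) * Complex.I) ^ 2) := by
  have hsum : ∀ ξ : ℝ, Complex.exp ((2 * π * ξ * u : ℝ) * Complex.I) *
      (thinnedExpCharFun q (2 * π * ξ) ^ N / (1 + (2 * π * ξ : ℝ) * Complex.I) ^ 2) =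
      ∑ j ∈ Finset.range (N + 1), ((q ^ j * (1 - q) ^ (N - j) * N.choose j : ℝ) : ℂ) *
        (Complex.exp ((2 * π * ξ * u : ℝ) * Complex.I) *
          (1 / (1 + (2 * π * ξ : ℝ) * Complex.I) ^ (j + 2))) := by
    intro ξ
    rw [thinnedExpCharFun, add_comm, add_pow, Finset.sum_div, Finset.mul_sum]
    refine Finset.sum_congr rfl fun j _ => ?_
    have := one_add_mul_I_ne_zero (2 * π * ξ)
    rw [div_pow, pow_add _ j 2]
    push_cast at this ⊢
    field_simp
  have hinteg : ∀ j : ℕ, Integrable fun ξ : ℝ => Complex.exp ((2 * π * ξ * u : ℝ) * Complex.I) *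
      (1 / (1 + (2 * π * ξ : ℝ) * Complex.I) ^ (j + 2)) := by
    intro j
    refine (integrable_one_div_one_add_mul_I_pow j).bdd_mul (c := 1)
      (Continuous.aestronglyMeasurable (by fun_prop)) (ae_of_all _ fun ξ => ?_)
    rw [Complex.norm_exp_ofReal_mul_I]
  simp only [hsum]
  rw [integral_finsetSum _ fun j _ => (hinteg j).const_mul _]
  simp only [integral_const_mul, ← erlangDensity_succ_eq_integral, binomialErlangDensity]
  push_cast
  rfl

/-- The density `binomialErlangDensity q N`, centered at `N * q` and rescaled by `√N`. -/
noncomputable def rescaledDensity (q : ℝ) (N : ℕ) (v : ℝ) : ℝ :=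
  √N * binomialErlangDensity q N (N * q + √N * v)

theorem rescaledDensity_eq_integral (q : ℝ) {N : ℕ} (hN : N ≠ 0) (v : ℝ) :
    (rescaledDensity q N v : ℂ) = ∫ w : ℝ, Complex.exp ((2 * π * w * v : ℝ) * Complex.I) *
      ((Complex.exp ((q * (2 * π * w / √N) : ℝ) * Complex.I) *
        thinnedExpCharFun q (2 * π * w / √N)) ^ N /
          (1 + (2 * π * w / √N : ℝ) * Complex.I) ^ 2) := by
  have hs : 0 < √(N : ℝ) := by positivity
  rw [rescaledDensity, Complex.ofReal_mul, binomialErlangDensity_eq_integral]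
  have h := Measure.integral_comp_mul_left (fun ξ : ℝ =>
    Complex.exp ((2 * π * ξ * (N * q + √N * v) : ℝ) * Complex.I) *
      (thinnedExpCharFun q (2 * π * ξ) ^ N / (1 + (2 * π * ξ : ℝ) * Complex.I) ^ 2)) (√N)⁻¹
  rw [inv_inv, abs_of_pos hs, Complex.real_smul] at h
  rw [← h]
  refine integral_congr_ae (ae_of_all _ fun w => ?_)
  have e1 : 2 * π * ((√N)⁻¹ * w) = 2 * π * w / √N := by field_simp
  have e2 : 2 * π * ((√N)⁻¹ * w) * (N * q + √N * v) =
      2 * π * w * v + N * (q * (2 * π * w / √N)) := by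
    field_simp
    ring
  simp only [e2]
  simp only [e1]
  rw [mul_pow, ← Complex.exp_nat_mul, Complex.ofReal_add, add_mul, Complex.exp_add,
    Complex.ofReal_mul (N : ℝ)]
  push_cast
  ring_nf

theorem thinnedExpCharFun_eq_div (q θ : ℝ) :
    thinnedExpCharFun q θ = (1 + ((1 - q) * θ : ℝ) * Complex.I) / (1 + θ * Complex.I) := by
  have := one_add_mul_I_ne_zero θ
  rw [thinnedExpCharFun]
  push_cast
  field_simp
  ring

theorem norm_thinnedExpCharFun_le (q θ : ℝ) :
    ‖thinnedExpCharFun q θ‖ ≤ 1 - q * (2 - q) / 2 * θ ^ 2 / (1 + θ ^ 2) := by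
  have hp : 0 < 1 + θ ^ 2 := by positivity
  have hx : q * (2 - q) * θ ^ 2 / (1 + θ ^ 2) ≤ 1 := by
    rw [div_le_one hp]
    nlinarith [sq_nonneg θ, sq_nonneg (1 - q), mul_nonneg (sq_nonneg θ) (sq_nonneg (1 - q))]
  have hsq : ‖thinnedExpCharFun q θ‖ ^ 2 = 1 - q * (2 - q) * θ ^ 2 / (1 + θ ^ 2) := by
    rw [thinnedExpCharFun_eq_div, norm_div, div_pow, norm_one_add_mul_I_sq, norm_one_add_mul_I_sq]
    field_simp
    ring
  have e : q * (2 - q) / 2 * θ ^ 2 / (1 + θ ^ 2) = q * (2 - q) * θ ^ 2 / (1 + θ ^ 2) / 2 := by ring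
  rw [e]
  refine abs_le_of_sq_le_sq' ?_ (by linarith) |>.2
  nlinarith [sq_nonneg (q * (2 - q) * θ ^ 2 / (1 + θ ^ 2))]

theorem norm_integrand_le {q : ℝ} (hq0 : 0 ≤ q) (hq1 : q ≤ 1) {N : ℕ} (hN : N ≠ 0) (x : ℝ) :
    ‖(Complex.exp ((q * (x / √N) : ℝ) * Complex.I) * thinnedExpCharFun q (x / √N)) ^ N /
      (1 + (x / √N : ℝ) * Complex.I) ^ 2‖ ≤ (1 + q * (2 - q) / 2 * x ^ 2)⁻¹ := by
  have hN' : (0 : ℝ) < N := by positivity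
  set θ := x / √N with hθ
  have hθ2 : N * θ ^ 2 = x ^ 2 := by
    rw [hθ, div_pow, Real.sq_sqrt hN'.le]
    field_simp
  have hp : 0 < 1 + θ ^ 2 := by positivity
  have hs : 0 ≤ q * (2 - q) / 2 := by
    have : 0 ≤ 2 - q := by linarith
    positivity
  set y := q * (2 - q) / 2 * θ ^ 2 / (1 + θ ^ 2) with hy
  have hy0 : 0 ≤ y := by positivity
  have h1 : ‖thinnedExpCharFun q θ‖ ≤ (1 + y)⁻¹ := by
    refine (norm_thinnedExpCharFun_le q θ).trans ?_
    rw [← hy, ← one_div, le_div_iff₀ (by positivity)]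
    nlinarith
  have h2 : ‖thinnedExpCharFun q θ‖ ^ N ≤ (1 + N * y)⁻¹ := by
    refine (pow_le_pow_left₀ (norm_nonneg _) h1 N).trans ?_
    rw [inv_pow]
    exact inv_anti₀ (by positivity) (one_add_mul_le_pow (by linarith) N)
  rw [norm_div, norm_pow, norm_mul, Complex.norm_exp_ofReal_mul_I, one_mul, norm_pow,
    norm_one_add_mul_I_sq]
  calc ‖thinnedExpCharFun q θ‖ ^ N / (1 + θ ^ 2) ≤ (1 + N * y)⁻¹ / (1 + θ ^ 2) := by gcongr
    _ = (1 + θ ^ 2 + q * (2 - q) / 2 * x ^ 2)⁻¹ := by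
      rw [← hθ2, hy]
      field_simp
    _ ≤ _ := inv_anti₀ (by positivity) (by nlinarith [sq_nonneg θ])

theorem norm_exp_mul_thinnedExpCharFun_sub_le {q : ℝ} (hq0 : 0 ≤ q) (hq1 : q ≤ 1) {θ : ℝ}
    (hθ : |θ| ≤ 1) :
    ‖(Complex.exp ((q * θ : ℝ) * Complex.I) * thinnedExpCharFun q θ - 1) -
      (-(q * (2 - q) / 2 * θ ^ 2 : ℝ) / (1 + θ * Complex.I))‖ ≤ 2 * |θ| ^ 3 := by
  set z : ℂ := (q * θ : ℝ) * Complex.I with hz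
  have hzn : ‖z‖ ≤ |θ| := by
    rw [hz, norm_mul, Complex.norm_I, mul_one, Complex.norm_real, norm_mul, Real.norm_eq_abs,
      Real.norm_eq_abs, abs_of_nonneg hq0]
    exact mul_le_of_le_one_left (abs_nonneg _) hq1
  have hb := Complex.exp_bound (hzn.trans hθ) (n := 3) (by norm_num)
  have hsum : ∑ m ∈ Finset.range 3, z ^ m / (m.factorial : ℂ) = 1 + z + z ^ 2 / 2 := by
    simp [Finset.sum_range_succ, Nat.factorial]
  rw [hsum] at hb
  have hR : ‖Complex.exp z - (1 + z + z ^ 2 / 2)‖ ≤ |θ| ^ 3 / 2 := by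
    refine hb.trans ?_
    norm_num [Nat.factorial]
    have := pow_le_pow_left₀ (norm_nonneg z) hzn 3
    have h0 : 0 ≤ |θ| ^ 3 := by positivity
    linarith
  have hne := one_add_mul_I_ne_zero θ
  have hr0 : 0 ≤ 1 - q := by linarith
  have key : (Complex.exp z * thinnedExpCharFun q θ - 1) -
      (-(q * (2 - q) / 2 * θ ^ 2 : ℝ) / (1 + θ * Complex.I)) =
      ((Complex.exp z - (1 + z + z ^ 2 / 2)) * (1 + ((1 - q) * θ : ℝ) * Complex.I) -
        ((1 - q) * q ^ 2 / 2 * θ ^ 3 : ℝ) * Complex.I) / (1 + θ * Complex.I) := by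
    rw [thinnedExpCharFun_eq_div, eq_div_iff hne, sub_mul, div_mul_cancel₀ _ hne, sub_mul,
      mul_assoc, div_mul_cancel₀ _ hne, hz]
    push_cast
    linear_combination ((q : ℂ) ^ 2 * θ ^ 2 / 2 + (1 - q) * q * θ ^ 2 +
      (1 - q) * q ^ 2 / 2 * θ ^ 3 * Complex.I) * Complex.I_sq
  rw [key, norm_div]
  refine (div_le_self (norm_nonneg _) (one_le_norm_one_add_mul_I θ)).trans ?_
  refine (norm_sub_le _ _).trans ?_
  have h1 : ‖1 + ((1 - q) * θ : ℝ) * Complex.I‖ ≤ 2 := by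
    refine (norm_add_le _ _).trans ?_
    rw [norm_one, norm_mul, Complex.norm_I, mul_one, Complex.norm_real, norm_mul,
      Real.norm_eq_abs, Real.norm_eq_abs, abs_of_nonneg hr0]
    nlinarith [abs_nonneg θ]
  have h2 : ‖(((1 - q) * q ^ 2 / 2 * θ ^ 3 : ℝ) : ℂ) * Complex.I‖ ≤ |θ| ^ 3 := by
    rw [norm_mul, Complex.norm_I, mul_one, Complex.norm_real, norm_mul, Real.norm_eq_abs,
      Real.norm_eq_abs, abs_pow, abs_of_nonneg (by positivity)]
    refine mul_le_of_le_one_left (by positivity) ?_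
    have : q ^ 2 ≤ 1 := pow_le_one₀ hq0 hq1
    nlinarith
  rw [norm_mul]
  have h3 := mul_le_mul hR h1 (norm_nonneg _) (by positivity)
  linarith

theorem tendsto_div_sqrt_natCast (x : ℝ) : Tendsto (fun N : ℕ => x / √N) atTop (nhds 0) :=
  tendsto_const_nhds.div_atTop (tendsto_sqrt_atTop.comp tendsto_natCast_atTop_atTop)

theorem tendsto_one_add_div_sqrt_mul_I (x : ℝ) :
    Tendsto (fun N : ℕ => 1 + ((x / √N : ℝ) : ℂ) * Complex.I) atTop (nhds 1) := by
  have h := ((Complex.continuous_ofReal.tendsto 0).comp (tendsto_div_sqrt_natCast x)).mul_const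
    Complex.I |>.const_add 1
  simpa using h

theorem tendsto_exp_mul_thinnedExpCharFun_pow {q : ℝ} (hq0 : 0 ≤ q) (hq1 : q ≤ 1) (x : ℝ) :
    Tendsto (fun N : ℕ => (Complex.exp ((q * (x / √N) : ℝ) * Complex.I) *
      thinnedExpCharFun q (x / √N)) ^ N) atTop
      (nhds (Complex.exp (-(q * (2 - q) / 2 * x ^ 2 : ℝ)))) := by
  have hθ := tendsto_div_sqrt_natCast x
  have hsq : ∀ N : ℕ, N ≠ 0 → N * (x / √N) ^ 2 = x ^ 2 := by
    intro N hN
    rw [div_pow, Real.sq_sqrt (by positivity)]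
    field_simp
  have hmain : Tendsto (fun N : ℕ => -((q * (2 - q) / 2 * x ^ 2 : ℝ) : ℂ) /
      (1 + ((x / √N : ℝ) : ℂ) * Complex.I)) atTop
      (nhds (-(q * (2 - q) / 2 * x ^ 2 : ℝ))) := by
    have h := (tendsto_const_nhds (x := -((q * (2 - q) / 2 * x ^ 2 : ℝ) : ℂ))).div
      (tendsto_one_add_div_sqrt_mul_I x) one_ne_zero
    rw [div_one] at h
    exact h
  have hbound : Tendsto (fun N : ℕ => 2 * x ^ 2 * |x / √N|) atTop (nhds 0) := by
    simpa using hθ.abs.const_mul (2 * x ^ 2)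
  have herr : Tendsto (fun N : ℕ => (N : ℂ) * (Complex.exp ((q * (x / √N) : ℝ) * Complex.I) *
      thinnedExpCharFun q (x / √N) - 1) - -((q * (2 - q) / 2 * x ^ 2 : ℝ) : ℂ) /
      (1 + ((x / √N : ℝ) : ℂ) * Complex.I)) atTop (nhds 0) := by
    refine squeeze_zero_norm' ?_ hbound
    have hsmall : ∀ᶠ N : ℕ in atTop, |x / √N| < 1 := by
      have := hθ.abs
      rw [abs_zero] at this
      exact this.eventually (gt_mem_nhds one_pos)
    filter_upwards [hsmall, eventually_ne_atTop 0] with N hN hN0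
    have h := norm_exp_mul_thinnedExpCharFun_sub_le hq0 hq1 hN.le
    have e : -((q * (2 - q) / 2 * x ^ 2 : ℝ) : ℂ) =
        N * -((q * (2 - q) / 2 * (x / √N) ^ 2 : ℝ) : ℂ) := by
      rw [← hsq N hN0]
      push_cast
      ring
    rw [e, mul_div_assoc, ← mul_sub, norm_mul, Complex.norm_natCast]
    refine (mul_le_mul_of_nonneg_left h (Nat.cast_nonneg N)).trans (le_of_eq ?_)
    rw [← hsq N hN0, pow_succ, sq_abs]
    ring
  have := Complex.tendsto_one_add_pow_exp_of_tendsto (by simpa using herr.add hmain)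
  simpa using this

theorem integrable_inv_one_add_mul_sq {c : ℝ} (hc : 0 < c) :
    Integrable fun w : ℝ => (1 + c * (2 * π * w) ^ 2)⁻¹ := by
  have h := integrable_inv_one_add_sq.comp_mul_left' (R := √c * (2 * π)) (by positivity)
  refine h.congr (ae_of_all _ fun w => ?_)
  simp only [mul_pow, Real.sq_sqrt hc.le, mul_assoc]

theorem abs_rescaledDensity_le {q : ℝ} (hq0 : 0 < q) (hq1 : q ≤ 1) {N : ℕ} (hN : N ≠ 0) (v : ℝ) :
    |rescaledDensity q N v| ≤ ∫ w : ℝ, (1 + q * (2 - q) / 2 * (2 * π * w) ^ 2)⁻¹ := by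
  have hs : 0 < q * (2 - q) / 2 := by
    have : 0 < 2 - q := by linarith
    positivity
  rw [← Real.norm_eq_abs, ← Complex.norm_real, rescaledDensity_eq_integral q hN]
  refine norm_integral_le_of_norm_le (integrable_inv_one_add_mul_sq hs) (ae_of_all _ fun w => ?_)
  rw [norm_mul, Complex.norm_exp_ofReal_mul_I, one_mul]
  exact norm_integrand_le hq0.le hq1 hN _

theorem continuous_thinnedExpCharFun (q : ℝ) : Continuous (thinnedExpCharFun q) :=
  continuous_const.add (continuous_const.div (by fun_prop) one_add_mul_I_ne_zero)

open FourierTransform in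
theorem integral_cexp_mul_gaussian {s : ℝ} (hs : 0 < s) (v : ℝ) :
    ∫ w : ℝ, Complex.exp ((2 * π * w * v : ℝ) * Complex.I) *
      Complex.exp (-(s / 2 * (2 * π * w) ^ 2 : ℝ)) =
      ((√(2 * π * s))⁻¹ * exp (-v ^ 2 / (2 * s)) : ℝ) := by
  have h := congrFun (fourier_gaussian_pi (b := (2 * π * s : ℝ))
    (by rw [Complex.ofReal_re]; positivity)) (-v)
  rw [Real.fourier_real_eq_integral_exp_smul] at h
  have e : ∀ w : ℝ, Complex.exp ((2 * π * w * v : ℝ) * Complex.I) *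
      Complex.exp (-(s / 2 * (2 * π * w) ^ 2 : ℝ)) =
      Complex.exp ((-2 * π * w * (-v) : ℝ) * Complex.I) •
        Complex.exp (-π * (2 * π * s : ℝ) * (w : ℂ) ^ 2) := by
    intro w
    rw [smul_eq_mul]
    congr 2
    · congr 2
      ring
    · push_cast
      ring
  simp only [e]
  rw [h, Real.sqrt_eq_rpow, Complex.ofReal_mul (_⁻¹), Complex.ofReal_inv,
    Complex.ofReal_cpow (by positivity), Complex.ofReal_exp, one_div]
  congr 2
  · push_cast
    rfl
  · push_cast
    have : (π : ℂ) ≠ 0 := by exact_mod_cast pi_ne_zero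
    have : (s : ℂ) ≠ 0 := by exact_mod_cast hs.ne'
    field_simp

theorem tendsto_rescaledDensity {q : ℝ} (hq0 : 0 < q) (hq1 : q ≤ 1) (v : ℝ) :
    Tendsto (fun N => rescaledDensity q N v) atTop
      (nhds ((√(2 * π * (q * (2 - q))))⁻¹ * exp (-v ^ 2 / (2 * (q * (2 - q)))))) := by
  have hs : 0 < q * (2 - q) := by
    have : 0 < 2 - q := by linarith
    positivity
  rw [← tendsto_add_atTop_iff_nat 1]
  have h : Tendsto (fun N : ℕ => (rescaledDensity q (N + 1) v : ℂ)) atTop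
      (nhds (((√(2 * π * (q * (2 - q))))⁻¹ * exp (-v ^ 2 / (2 * (q * (2 - q)))) : ℝ) : ℂ)) := by
    rw [← integral_cexp_mul_gaussian hs]
    simp only [rescaledDensity_eq_integral q (Nat.succ_ne_zero _)]
    refine tendsto_integral_of_dominated_convergence
      (fun w => (1 + q * (2 - q) / 2 * (2 * π * w) ^ 2)⁻¹) (fun N => ?_)
      (integrable_inv_one_add_mul_sq (by positivity)) (fun N => ae_of_all _ fun w => ?_)
      (ae_of_all _ fun w => ?_)
    · have := continuous_thinnedExpCharFun q
      refine Continuous.aestronglyMeasurable (Continuous.mul (by fun_prop)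
        (Continuous.div (by fun_prop) (by fun_prop)
          fun w => pow_ne_zero _ (one_add_mul_I_ne_zero _)))
    · rw [norm_mul, Complex.norm_exp_ofReal_mul_I, one_mul]
      exact norm_integrand_le hq0.le hq1 (Nat.succ_ne_zero _) _
    · have h1 := tendsto_exp_mul_thinnedExpCharFun_pow hq0.le hq1 (2 * π * w)
      have h2 := (tendsto_one_add_div_sqrt_mul_I (2 * π * w)).pow 2
      have h3 := h1.div h2 (by simp)
      rw [one_pow, div_one] at h3
      exact ((tendsto_add_atTop_iff_nat 1).2 h3).const_mul _
  have := (Complex.continuous_re.tendsto _).comp h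
  simpa only [Function.comp_def, Complex.ofReal_re] using this

end GammaMixture

section Scheffe

open MeasureTheory

theorem tendsto_integral_abs_sub_of_tendsto {α : Type*} [MeasurableSpace α] {μ : Measure α}
    {G : ℕ → α → ℝ} {φ : α → ℝ} (hG0 : ∀ n x, 0 ≤ G n x) (hφ0 : ∀ x, 0 ≤ φ x)
    (hG : ∀ n, Integrable (G n) μ) (hφ : Integrable φ μ)
    (heq : ∀ n, ∫ x, G n x ∂μ = ∫ x, φ x ∂μ)
    (hlim : ∀ x, Tendsto (fun n => G n x) atTop (nhds (φ x))) :
    Tendsto (fun n => ∫ x, |G n x - φ x| ∂μ) atTop (nhds 0) := by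
  have h : ∀ n, ∫ x, |G n x - φ x| ∂μ = 2 * ∫ x, max (φ x - G n x) 0 ∂μ := by
    intro n
    have e : ∀ x, |G n x - φ x| = (G n x - φ x) + 2 * max (φ x - G n x) 0 := by
      intro x
      rcases le_total (G n x) (φ x) with h | h
      · rw [abs_of_nonpos (by linarith), max_eq_left (by linarith)]; ring
      · rw [abs_of_nonneg (by linarith), max_eq_right (by linarith)]; ring
    simp only [e]
    have hsub : Integrable (fun x => G n x - φ x) μ := (hG n).sub hφ
    have hpos : Integrable (fun x => 2 * max (φ x - G n x) 0) μ :=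
      (hφ.sub (hG n)).pos_part.const_mul 2
    rw [integral_add hsub hpos, integral_sub (hG n) hφ, heq n, sub_self, zero_add, integral_const_mul]
  simp only [h]
  have hdom : Tendsto (fun n => ∫ x, max (φ x - G n x) 0 ∂μ) atTop (nhds (∫ _, (0 : ℝ) ∂μ)) := by
    refine tendsto_integral_of_dominated_convergence φ
      (fun n => (hφ.sub (hG n)).pos_part.aestronglyMeasurable) hφ
      (fun n => ae_of_all _ fun x => ?_) (ae_of_all _ fun x => ?_)
    · rw [Real.norm_of_nonneg (le_max_right _ _)]
      exact max_le (by linarith [hG0 n x]) (hφ0 x)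
    · have := ((hlim x).const_sub (φ x)).max (tendsto_const_nhds (x := (0 : ℝ)))
      simpa using this
  simpa using hdom.const_mul 2

theorem integrable_pow_of_bounded {α : Type*} [MeasurableSpace α] {μ : Measure α} {f : α → ℝ}
    (hf : Integrable f μ) {C : ℝ} (hC : ∀ x, |f x| ≤ C) (m : ℕ) :
    Integrable (fun x => f x ^ (m + 1)) μ := by
  simp only [pow_succ]
  refine hf.bdd_mul (c := C ^ m) (hf.aestronglyMeasurable.pow m) (ae_of_all _ fun x => ?_)
  rw [norm_pow]
  exact pow_le_pow_left₀ (norm_nonneg _) (hC x) m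

theorem tendsto_integral_pow_of_tendsto {α : Type*} [MeasurableSpace α] {μ : Measure α}
    {G : ℕ → α → ℝ} {φ : α → ℝ} (hG0 : ∀ n x, 0 ≤ G n x) (hφ0 : ∀ x, 0 ≤ φ x)
    (hG : ∀ n, Integrable (G n) μ) (hφ : Integrable φ μ)
    (heq : ∀ n, ∫ x, G n x ∂μ = ∫ x, φ x ∂μ)
    (hlim : ∀ x, Tendsto (fun n => G n x) atTop (nhds (φ x)))
    {C : ℝ} (hC : ∀ n x, |G n x| ≤ C) (m : ℕ) :
    Tendsto (fun n => ∫ x, G n x ^ (m + 1) ∂μ) atTop (nhds (∫ x, φ x ^ (m + 1) ∂μ)) := by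
  have hCφ : ∀ x, |φ x| ≤ C := fun x => le_of_tendsto' (hlim x).abs fun n => hC n x
  rw [tendsto_iff_norm_sub_tendsto_zero]
  have h := (tendsto_integral_abs_sub_of_tendsto hG0 hφ0 hG hφ heq hlim).mul_const
    (((m + 1 : ℕ) : ℝ) * C ^ m)
  rw [zero_mul] at h
  refine squeeze_zero (fun _ => norm_nonneg _) (fun n => ?_) h
  rw [← integral_sub (integrable_pow_of_bounded (hG n) (hC n) m)
    (integrable_pow_of_bounded hφ hCφ m), ← integral_mul_const]
  refine norm_integral_le_of_norm_le (((hG n).sub hφ).abs.mul_const _) (ae_of_all _ fun x => ?_)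
  refine (abs_pow_sub_pow_le (G n x) (φ x) (m + 1)).trans ?_
  rw [mul_assoc, Nat.add_sub_cancel]
  gcongr
  exact max_le (hC n x) (hCφ x)

end Scheffe

section Asymptotics

open MeasureTheory Set

theorem integral_comp_add_mul (F : ℝ → ℝ) (a : ℝ) {s : ℝ} (hs : 0 < s) :
    ∫ v, F (a + s * v) = s⁻¹ * ∫ u, F u := by
  rw [Measure.integral_comp_mul_left (fun y => F (a + y)) s, integral_add_left_eq_self,
    abs_of_pos (inv_pos.2 hs), smul_eq_mul]

theorem integral_gaussian_pow {s : ℝ} (hs : 0 < s) (m : ℕ) :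
    ∫ v : ℝ, ((√(2 * π * s))⁻¹ * exp (-v ^ 2 / (2 * s))) ^ (m + 1) =
      (√(2 * π * s))⁻¹ ^ (m + 1) * √(2 * π * s / (m + 1)) := by
  have e : ∀ v : ℝ, ((√(2 * π * s))⁻¹ * exp (-v ^ 2 / (2 * s))) ^ (m + 1) =
      (√(2 * π * s))⁻¹ ^ (m + 1) * exp (-((m + 1) / (2 * s)) * v ^ 2) := by
    intro v
    rw [mul_pow, ← Real.exp_nat_mul]
    congr 2
    push_cast
    field_simp
  simp only [e]
  rw [integral_const_mul, integral_gaussian]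
  congr 2
  field_simp

theorem tendsto_integral_rescaledDensity_pow {q : ℝ} (hq0 : 0 < q) (hq1 : q ≤ 1) (m : ℕ) :
    Tendsto (fun N => ∫ v, rescaledDensity q N v ^ (m + 1)) atTop
      (nhds ((√(2 * π * (q * (2 - q))))⁻¹ ^ (m + 1) * √(2 * π * (q * (2 - q)) / (m + 1)))) := by
  have hs : 0 < q * (2 - q) := by
    have : 0 < 2 - q := by linarith
    positivity
  rw [← integral_gaussian_pow hs, ← tendsto_add_atTop_iff_nat 1]
  have hφ1 : ∫ v, (√(2 * π * (q * (2 - q))))⁻¹ * exp (-v ^ 2 / (2 * (q * (2 - q)))) = 1 := by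
    have := integral_gaussian_pow hs 0
    simp only [zero_add, pow_one, Nat.cast_zero, div_one] at this
    rw [this]
    exact inv_mul_cancel₀ (by positivity)
  have hG1 : ∀ N : ℕ, ∫ v, rescaledDensity q (N + 1) v = 1 := by
    intro N
    have hN : 0 < √((N + 1 : ℕ) : ℝ) := by positivity
    simp only [rescaledDensity]
    rw [integral_const_mul, integral_comp_add_mul _ _ hN, integral_binomialErlangDensity,
      mul_one, mul_inv_cancel₀ hN.ne']
  refine tendsto_integral_pow_of_tendsto (G := fun N => rescaledDensity q (N + 1))
    (fun N v => mul_nonneg (sqrt_nonneg _) (binomialErlangDensity_nonneg hq0.le hq1 _ _))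
    (fun v => by positivity) (fun N => ?_) ?_ (fun N => by rw [hG1, hφ1])
    (fun v => (tendsto_add_atTop_iff_nat 1).2 (tendsto_rescaledDensity hq0 hq1 v))
    (fun N v => abs_rescaledDensity_le hq0 hq1 (Nat.succ_ne_zero N) v) m
  · exact Integrable.of_integral_ne_zero (by rw [hG1]; exact one_ne_zero)
  · exact Integrable.of_integral_ne_zero (by rw [hφ1]; exact one_ne_zero)

theorem exp_neg_mul_eval_rookPoly_succ {x : ℝ} (hx : 0 < x) (N : ℕ) {u : ℝ} (hu : 0 < u) :
    exp (-u) * (rookPoly (N + 1)).eval (x * u) =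
      x * (x + 1) ^ N * binomialErlangDensity (x / (x + 1)) N u := by
  simp only [rookPoly, binomialErlangDensity, Polynomial.eval_finsetSum, Finset.mul_sum]
  refine Finset.sum_congr rfl fun j hj => ?_
  have hj' : j ≤ N := Nat.lt_succ_iff.1 (Finset.mem_range.1 hj)
  have h1 : 1 - x / (x + 1) = 1 / (x + 1) := by
    field_simp
    ring
  rw [h1, erlangDensity, indicator_of_mem (mem_Ioi.2 hu)]
  have h2 : (x + 1) ^ N = (x + 1) ^ j * (x + 1) ^ (N - j) := by
    rw [← pow_add, Nat.add_sub_cancel' hj']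
  rw [h2, div_pow, div_pow, one_pow]
  simp only [Polynomial.eval_mul, Polynomial.eval_C, Polynomial.eval_pow, Polynomial.eval_X]
  have : (0 : ℝ) < (j + 1).factorial := by positivity
  field_simp
  ring

theorem binomialErlangDensity_of_nonpos (q : ℝ) (N : ℕ) {u : ℝ} (hu : u ≤ 0) :
    binomialErlangDensity q N u = 0 := by
  refine Finset.sum_eq_zero fun j _ => ?_
  rw [erlangDensity, indicator_of_notMem (by simpa using hu), mul_zero]

theorem rookWalkCount_diag_eq_integral {d : ℕ} (hd : d ≠ 0) (N : ℕ) :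
    (rookWalkCount d (fun _ => N + 1) : ℝ) = d * ((d * (d + 1) ^ N) ^ d *
      ∫ u, binomialErlangDensity (d / (d + 1)) N u ^ d) := by
  have hd0 : (0 : ℝ) < d := by positivity
  have hsub := integral_comp_mul_left_Ioi
    (fun t => exp (-t) * ∏ _i : Fin d, (rookPoly (N + 1)).eval t) 0 hd0
  rw [mul_zero, smul_eq_mul, eq_inv_mul_iff_mul_eq₀ hd0.ne'] at hsub
  rw [rookWalkCount_eq_integral, ← hsub]
  congr 1
  rw [← integral_const_mul, ← integral_indicator measurableSet_Ioi]
  refine integral_congr_ae (ae_of_all _ fun u => ?_)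
  by_cases hu : 0 < u
  · simp only
    rw [indicator_of_mem (mem_Ioi.2 hu), ← mul_pow, ← exp_neg_mul_eval_rookPoly_succ hd0 N hu,
      mul_pow, ← Real.exp_nat_mul]
    simp
  · simp only
    rw [indicator_of_notMem (by simpa using hu),
      binomialErlangDensity_of_nonpos _ _ (not_lt.1 hu), zero_pow hd, mul_zero]

theorem inv_sqrt_pow_eq_rpow {x : ℝ} (hx : 0 < x) (m : ℕ) :
    (√x ^ m)⁻¹ = x ^ ((1 - ((m + 1 : ℕ) : ℝ)) / 2) := by
  rw [Real.sqrt_eq_rpow, ← Real.rpow_natCast, ← Real.rpow_mul hx.le, ← Real.rpow_neg hx.le]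
  congr 1
  push_cast
  ring

theorem rookWalkCount_diag_eq_rescaled (m : ℕ) {N : ℕ} (hN : N ≠ 0) :
    (rookWalkCount (m + 1) (fun _ => N + 1) : ℝ) =
      ((m + 1 : ℕ) : ℝ) * ((((m + 1 : ℕ) : ℝ) * (((m + 1 : ℕ) : ℝ) + 1) ^ N) ^ (m + 1) *
        ((√N ^ m)⁻¹ * ∫ v, rescaledDensity (((m + 1 : ℕ) : ℝ) / (((m + 1 : ℕ) : ℝ) + 1)) N v ^
          (m + 1))) := by
  have hs : 0 < √(N : ℝ) := by positivity
  rw [rookWalkCount_diag_eq_integral (Nat.succ_ne_zero m)]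
  congr 2
  simp only [rescaledDensity, mul_pow]
  rw [integral_const_mul,
    integral_comp_add_mul (fun u => binomialErlangDensity _ N u ^ (m + 1)) _ hs]
  field_simp
  ring

theorem rook_constant_eq (m : ℕ) {x s : ℝ} (hx : x = ((m + 1 : ℕ) : ℝ))
    (hs : s = x / (x + 1) * (2 - x / (x + 1))) :
    x * (x / (x + 1)) ^ (m + 1) * ((√(2 * π * s))⁻¹ ^ (m + 1) * √(2 * π * s / (m + 1))) =
      √(x ^ (m + 1 + 2) / ((x + 2) ^ m * (x + 1) ^ 2 * 2 ^ m)) * (√π ^ m)⁻¹ := by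
  have hx0 : 0 < x := by rw [hx]; positivity
  have hs' : s = x * (x + 2) / (x + 1) ^ 2 := by
    rw [hs]
    field_simp
    ring
  have hs0 : 0 < s := by rw [hs']; positivity
  have hm : (m : ℝ) + 1 = x := by rw [hx]; push_cast; rfl
  have hπ := pi_pos
  rw [← sq_eq_sq₀ (by positivity) (by positivity), hm]
  simp only [mul_pow, inv_pow, ← pow_mul]
  rw [mul_comm (m + 1) 2, mul_comm m 2, pow_mul (√(2 * π * s)), pow_mul (√π),
    Real.sq_sqrt (by positivity), Real.sq_sqrt (by positivity), Real.sq_sqrt (by positivity),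
    Real.sq_sqrt (by positivity), hs']
  simp only [div_pow, mul_pow, ← pow_mul]
  field_simp
  ring

end Asymptotics

/-- Leading asymptotics of diagonal `d`-dimensional rook walk numbers
(Erickson–Fernando–Tran): for fixed `d ≥ 2`, with
`α_d = d^{d+2}/((d+2)^{d−1}(d+1)²2^{d−1})`, one has
`a_d(n,…,n) ~ √(α_d)·(nπ)^{(1−d)/2}·((d+1)^d)^n` as `n → ∞`. -/
theorem rook_diag_leading_asymptotics (d : ℕ) (hd : 2 ≤ d) :
    Filter.Tendsto
      (fun n : ℕ =>
        (rookWalkCount d (fun _ => n) : ℝ) /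
          (Real.sqrt ((d : ℝ) ^ (d + 2) /
              (((d : ℝ) + 2) ^ (d - 1) * ((d : ℝ) + 1) ^ 2 * 2 ^ (d - 1)))
            * ((n : ℝ) * Real.pi) ^ ((1 - (d : ℝ)) / 2)
            * (((d : ℝ) + 1) ^ d) ^ n))
      Filter.atTop (nhds 1) := by
  obtain ⟨m, rfl⟩ : ∃ m, d = m + 1 := ⟨d - 1, by omega⟩
  rw [← tendsto_add_atTop_iff_nat 1]
  set x : ℝ := ((m + 1 : ℕ) : ℝ) with hx
  have hx0 : 0 < x := by rw [hx]; positivity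
  have hJ := tendsto_integral_rescaledDensity_pow (q := x / (x + 1)) (by positivity)
    ((div_le_one (by positivity)).2 (by linarith)) m
  have hc := rook_constant_eq m hx rfl
  set J := (√(2 * π * (x / (x + 1) * (2 - x / (x + 1)))))⁻¹ ^ (m + 1) *
    √(2 * π * (x / (x + 1) * (2 - x / (x + 1))) / (m + 1))
  set R := √(x ^ (m + 1 + 2) / ((x + 2) ^ m * (x + 1) ^ 2 * 2 ^ m)) with hR
  have hR0 : 0 < R := by rw [hR]; positivity
  have hπ : 0 < √π := by positivity
  have hratio : Tendsto (fun N : ℕ => (√(N + 1 : ℝ) / √N) ^ m) atTop (nhds 1) := by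
    have h1 : Tendsto (fun N : ℕ => 1 + 1 / (N : ℝ)) atTop (nhds 1) := by
      simpa using tendsto_one_div_atTop_nhds_zero_nat.const_add (1 : ℝ)
    have h2 := (h1.sqrt).pow m
    rw [Real.sqrt_one, one_pow] at h2
    refine h2.congr' ?_
    filter_upwards [eventually_ne_atTop 0] with N hN
    have : (0 : ℝ) < N := by positivity
    rw [← Real.sqrt_div (by positivity)]
    congr 2
    field_simp
  have hmul := (hratio.mul hJ).const_mul (x * (x / (x + 1)) ^ (m + 1) / (R * (√π ^ m)⁻¹))
  have hone : x * (x / (x + 1)) ^ (m + 1) / (R * (√π ^ m)⁻¹) * (1 * J) = 1 := by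
    rw [one_mul, div_mul_eq_mul_div, hc]
    exact div_self (by positivity)
  rw [hone] at hmul
  refine hmul.congr' ?_
  filter_upwards [eventually_ne_atTop 0] with N hN
  have hN0 : (0 : ℝ) < N := by positivity
  rw [rookWalkCount_diag_eq_rescaled m hN, Nat.add_sub_cancel, ← hx, ← hR,
    ← inv_sqrt_pow_eq_rpow (by positivity), Real.sqrt_mul (by positivity)]
  have hs : 0 < √(N : ℝ) := by positivity
  have hs' : 0 < √((N : ℝ) + 1) := by positivity
  push_cast
  simp only [div_pow, mul_pow, ← pow_mul]
  field_simp
  ring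
end
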